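/- arXiv:2109.02508 — 4 statements merged into one kernel-verified Lean document; each statement's English description precedes it below -/
import Mathlib

section
/- Fix an integer p ≥ 1, reals a > 0 and b > 0, and a point y' ∈ ℝ^p. For any y_i ∈ ℝ^p with y_i ≠ y', the repulsive cost function y ↦ c^r(y, y') = −ln(1 − (1 + a‖y − y'‖₂^{2b})^{−1}) is differentiable at y_i, and its gradient there equals (−2b / (‖y_i − y'‖₂² (1 + a‖y_i − y'‖₂^{2b}))) · (y_i − y'). -/
open Real

/-- Derivative of the repulsive cost as a function of the squared distance. -/
theorem hasDerivAt_neg_log_one_sub_inv_one_add_mul_rpow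
    {a b s : ℝ} (ha : 0 < a) (hs : 0 < s) :
    HasDerivAt (fun t : ℝ => -Real.log (1 - (1 + a * t ^ b)⁻¹))
      (-b / (s * (1 + a * s ^ b))) s := by
  have hpow : 0 < s ^ b := Real.rpow_pos_of_pos hs b
  have hden : 0 < 1 + a * s ^ b := by positivity
  have hq : 1 - (1 + a * s ^ b)⁻¹ = a * s ^ b / (1 + a * s ^ b) := by
    field_simp
    ring
  have hq0 : 1 - (1 + a * s ^ b)⁻¹ ≠ 0 := by
    rw [hq]
    positivity
  have hderiv := ((((((Real.hasDerivAt_rpow_const (p := b) (Or.inl hs.ne')).const_mul a).const_add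
    1).fun_inv hden.ne').const_sub 1).log hq0).fun_neg
  convert! hderiv using 1
  rw [hq, Real.rpow_sub_one hs.ne']
  field_simp

/-- The gradient of a function of the squared distance to a fixed point. -/
theorem HasDerivAt.hasGradientAt_comp_norm_sub_sq
    {E : Type*} [NormedAddCommGroup E] [InnerProductSpace ℝ E] [CompleteSpace E]
    {g : ℝ → ℝ} {g' : ℝ} {x c : E} (hg : HasDerivAt g g' (‖x - c‖ ^ 2)) :
    HasGradientAt (fun y => g (‖y - c‖ ^ 2)) ((2 * g') • (x - c)) x := by
  rw [hasGradientAt_iff_hasFDerivAt]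
  have hderiv := hg.comp_hasFDerivAt x ((hasFDerivAt_id x).sub_const c).norm_sq
  convert! hderiv using 1
  ext v
  simp
  ring

/-- For `p ≥ 1`, `a > 0`, `b > 0`, `y' ∈ ℝ^p` and `y_i ≠ y'`,
the repulsive cost `y ↦ −ln(1 − (1 + a‖y − y'‖₂^{2b})⁻¹)` is differentiable at `y_i`
with gradient `(−2b / (‖y_i − y'‖₂² (1 + a‖y_i − y'‖₂^{2b}))) • (y_i − y')`. -/
theorem umap_repulsive_gradient_first_arg
    (p : ℕ) (hp : 1 ≤ p) (a b : ℝ) (ha : 0 < a) (hb : 0 < b)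
    (y' yi : EuclideanSpace ℝ (Fin p)) (hne : yi ≠ y') :
    HasGradientAt (fun y : EuclideanSpace ℝ (Fin p) =>
        -Real.log (1 - (1 + a * ‖y - y'‖ ^ (2 * b))⁻¹))
      ((-2 * b / (‖yi - y'‖ ^ 2 * (1 + a * ‖yi - y'‖ ^ (2 * b))))
        • (yi - y')) yi := by
  have hs : 0 < ‖yi - y'‖ ^ 2 := pow_pos (norm_pos_iff.mpr (sub_ne_zero.mpr hne)) 2
  have hpow (y : EuclideanSpace ℝ (Fin p)) : ‖y - y'‖ ^ (2 * b) = (‖y - y'‖ ^ 2) ^ b := by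
    rw [Real.rpow_mul (norm_nonneg _), Real.rpow_two]
  simp only [hpow]
  convert (hasDerivAt_neg_log_one_sub_inv_one_add_mul_rpow (b := b) ha
    hs).hasGradientAt_comp_norm_sub_sq using 2
  ring
end

section
/- Fix integers n ≥ 1, p ≥ 1, m ≥ 1, an index i ∈ {1,…,n}, a probability space (Ω, μ), and symmetric reals p_{jl} (p_{jl} = p_{lj}) for j, l ∈ {1,…,n}. For each j, l ∈ {1,…,n}, let I_j, I'_j, and J_{jl} : Ω → ℝ be random variables such that I_j, I'_j, and the products I_j · J_{jl} are integrable, with E[I_j] = p_{ij}, E[I'_j] = p_{ji}, and E[I_j · J_{jl}] = (m/n) · p_{ij}. Let A_1, …, A_n and R_1, …, R_n be fixed vectors in ℝ^p, and set d_i := Σ_{j=1}^n p_{ij}. Then E[ Σ_{j=1}^n ( I_j · A_j + I'_j · A_j + I_j · Σ_{l=1}^n J_{jl} · R_l ) ] = 2 · Σ_{j=1}^n ( p_{ij} · A_j + (d_i · m / (2n)) · R_j ), where the expectation of the ℝ^p-valued random vector is taken componentwise (Bochner integral). -/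
open Real Finset MeasureTheory

/-- expected per-epoch gradient of UMAP's cost with respect to `y_i`:
with `E[I_j] = p_{ij}`, `E[I'_j] = p_{ji}`, `E[I_j J_{jl}] = (m/n) p_{ij}`, symmetric
`p`, fixed vectors `A_j, R_j ∈ ℝ^p`, and `d_i = Σ_j p_{ij}`, the expectation of
`Σ_j (I_j A_j + I'_j A_j + I_j Σ_l J_{jl} R_l)` equals
`2 Σ_j (p_{ij} A_j + (d_i m/(2n)) R_j)`. -/
theorem umap_expected_gradient
    (n p m : ℕ) (hn : 1 ≤ n) (hp : 1 ≤ p) (hm : 1 ≤ m) (i : Fin n)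
    {Ω : Type*} [MeasurableSpace Ω] (μ : MeasureTheory.Measure Ω)
    [MeasureTheory.IsProbabilityMeasure μ]
    (P : Fin n → Fin n → ℝ) (hPsymm : ∀ j l, P j l = P l j)
    (I I' : Fin n → Ω → ℝ) (J : Fin n → Fin n → Ω → ℝ)
    (hI_int : ∀ j, MeasureTheory.Integrable (I j) μ)
    (hI'_int : ∀ j, MeasureTheory.Integrable (I' j) μ)
    (hIJ_int : ∀ j l, MeasureTheory.Integrable (fun ω => I j ω * J j l ω) μ)
    (hI_exp : ∀ j, ∫ ω, I j ω ∂μ = P i j)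
    (hI'_exp : ∀ j, ∫ ω, I' j ω ∂μ = P j i)
    (hIJ_exp : ∀ j l, ∫ ω, I j ω * J j l ω ∂μ = ((m : ℝ) / n) * P i j)
    (A R : Fin n → EuclideanSpace ℝ (Fin p)) :
    ∫ ω, (∑ j : Fin n,
        (I j ω • A j + I' j ω • A j + I j ω • ∑ l : Fin n, J j l ω • R l)) ∂μ
      =
    (2 : ℝ) • ∑ j : Fin n,
        (P i j • A j + ((∑ j' : Fin n, P i j') * m / (2 * n)) • R j) := by
  have hrep_int : ∀ j l, Integrable (fun ω => (I j ω * J j l ω) • R l) μ := fun j l =>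
    (hIJ_int j l).smul_const (R l)
  have hA_int : ∀ j, Integrable (fun ω => I j ω • A j) μ := fun j => (hI_int j).smul_const (A j)
  have hA'_int : ∀ j, Integrable (fun ω => I' j ω • A j) μ := fun j =>
    (hI'_int j).smul_const (A j)
  have hAA'_int : ∀ j, Integrable (fun ω => I j ω • A j + I' j ω • A j) μ := fun j =>
    (hA_int j).add (hA'_int j)
  have hsum_int : ∀ j, Integrable (fun ω => ∑ l, (I j ω * J j l ω) • R l) μ := fun j =>
    integrable_finsetSum _ fun l _ => hrep_int j l
  have hstep_int : ∀ j, Integrable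
      (fun ω => I j ω • A j + I' j ω • A j + ∑ l, (I j ω * J j l ω) • R l) μ := fun j =>
    (hAA'_int j).add (hsum_int j)
  have hterm : ∀ j, ∫ ω, (I j ω • A j + I' j ω • A j + ∑ l, (I j ω * J j l ω) • R l) ∂μ
      = (2 : ℝ) • P i j • A j + ∑ l, (((m : ℝ) / n) * P i j) • R l := by
    intro j
    rw [integral_add (hAA'_int j) (hsum_int j),
      integral_add (hA_int j) (hA'_int j), integral_finsetSum _ fun l _ => hrep_int j l]
    simp only [integral_smul_const, hI_exp, hI'_exp, hIJ_exp, hPsymm j i, two_smul]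
  have hn0 : (n : ℝ) ≠ 0 := by positivity
  simp only [Finset.smul_sum, smul_smul]
  rw [integral_finsetSum _ fun j _ => hstep_int j]
  simp only [hterm, smul_add, smul_smul, Finset.sum_add_distrib]
  congr 1
  rw [Finset.sum_comm]
  refine Finset.sum_congr rfl fun l _ => ?_
  rw [← Finset.sum_smul, ← Finset.mul_sum]
  congr 1
  field_simp
end

section
/- Fix integers n ≥ 1 and m ≥ 1, a probability space (Ω, μ), and for all i, j, l ∈ {1,…,n} with i ≠ j let I_{ij} and J_{ijl} : Ω → ℝ be random variables such that I_{ij} and the products I_{ij} · J_{ijl} are integrable, with E[I_{ij}] = p_{ij} and E[I_{ij} · J_{ijl}] = (m/n) · p_{ij}, where the reals p_{ij} satisfy p_{ij} = p_{ji} and p_{ii} = 0. Let C^a_{ij} and C^r_{il} be reals with C^a_{ij} = C^a_{ji}, C^r_{il} = C^r_{li}, and C^r_{ii} = 0, and set d_i := Σ_{j=1}^n p_{ij}. Then E[ Σ_{i=1}^n Σ_{j≠i} ( I_{ij} · C^a_{ij} + Σ_{l=1}^n I_{ij} · J_{ijl} · C^r_{il} ) ] = 2 · Σ_{i=1}^n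 Σ_{j=i+1}^n ( p_{ij} · C^a_{ij} + ((d_i + d_j) · m / (2n)) · C^r_{ij} ). -/
open Real Finset MeasureTheory

/-- The sum of a symmetric function vanishing on the diagonal is twice its sum over the pairs
`i < j`. -/
theorem sum_sum_eq_two_mul_sum_Ioi {ι R : Type*} [Fintype ι] [LinearOrder ι]
    [LocallyFiniteOrderTop ι] [LocallyFiniteOrderBot ι] [NonAssocSemiring R]
    (f : ι → ι → R) (hsymm : ∀ i j, f i j = f j i) (hdiag : ∀ i, f i i = 0) :
    ∑ i, ∑ j, f i j = 2 * ∑ i, ∑ j ∈ Finset.Ioi i, f i j := by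
  have h := Finset.sum_sum_Ioi_add_eq_sum_sum_off_diag f
  calc
    _ = ∑ i, ∑ j ∈ {i}ᶜ, f j i := by
      refine Finset.sum_congr rfl fun i _ => ?_
      rw [Fintype.sum_eq_add_sum_compl i, hdiag, zero_add]
      exact Finset.sum_congr rfl fun j _ => hsymm i j
    _ = _ := by
      rw [← h]
      simp only [Finset.mul_sum, two_mul]
      exact Finset.sum_congr rfl fun i _ => Finset.sum_congr rfl fun j _ => by rw [hsymm j i]

/-- Summing the repulsive cost `C i l` with weight `P i j` over all triples amounts to weighting
each pair by the average of the two degrees. -/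
theorem sum_sum_sum_mul_eq_sum_sum_avg {ι K : Type*} [Fintype ι] [Field K] [CharZero K]
    (P C : ι → ι → K) (hC : ∀ i l, C i l = C l i) :
    ∑ i, ∑ j, ∑ l, P i j * C i l
      = ∑ i, ∑ j, ((∑ l, P i l) + ∑ l, P j l) / 2 * C i j := by
  have h₁ : ∑ i, ∑ j, ∑ l, P i j * C i l = ∑ i, ∑ l, (∑ j, P i j) * C i l := by
    refine Finset.sum_congr rfl fun i _ => ?_
    rw [Finset.sum_comm]
    simp only [Finset.sum_mul]
  have h₂ : ∑ i, ∑ l, (∑ j, P i j) * C i l = ∑ i, ∑ l, (∑ j, P l j) * C i l := by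
    rw [Finset.sum_comm]
    exact Finset.sum_congr rfl fun i _ => Finset.sum_congr rfl fun l _ => by rw [hC]
  simp only [add_div, add_mul, Finset.sum_add_distrib, div_mul_eq_mul_div, ← Finset.sum_div,
    ← h₂, h₁, add_halves]

/-- UMAP's effective cost function. With `E[I_{ij}] = p_{ij}`,
`E[I_{ij} J_{ijl}] = (m/n) p_{ij}` for `i ≠ j`, symmetric `p` with zero diagonal,
symmetric attractive/repulsive costs `C^a`, `C^r` with `C^r_{ii} = 0`, and
`d_i = Σ_j p_{ij}`, the expectation of
`Σ_i Σ_{j≠i} (I_{ij} C^a_{ij} + Σ_l I_{ij} J_{ijl} C^r_{il})` equals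
`2 Σ_i Σ_{j>i} (p_{ij} C^a_{ij} + ((d_i + d_j) m/(2n)) C^r_{ij})`. -/
theorem umap_effective_cost
    (n m : ℕ) (hn : 1 ≤ n) (hm : 1 ≤ m)
    {Ω : Type*} [MeasurableSpace Ω] (μ : MeasureTheory.Measure Ω)
    [MeasureTheory.IsProbabilityMeasure μ]
    (P : Fin n → Fin n → ℝ) (hPsymm : ∀ i j, P i j = P j i)
    (hPdiag : ∀ i, P i i = 0)
    (I : Fin n → Fin n → Ω → ℝ) (J : Fin n → Fin n → Fin n → Ω → ℝ)
    (hI_int : ∀ i j, i ≠ j → MeasureTheory.Integrable (I i j) μ)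
    (hIJ_int : ∀ i j l, i ≠ j →
      MeasureTheory.Integrable (fun ω => I i j ω * J i j l ω) μ)
    (hI_exp : ∀ i j, i ≠ j → ∫ ω, I i j ω ∂μ = P i j)
    (hIJ_exp : ∀ i j l, i ≠ j →
      ∫ ω, I i j ω * J i j l ω ∂μ = ((m : ℝ) / n) * P i j)
    (Ca Cr : Fin n → Fin n → ℝ)
    (hCa_symm : ∀ i j, Ca i j = Ca j i)
    (hCr_symm : ∀ i l, Cr i l = Cr l i)
    (hCr_diag : ∀ i, Cr i i = 0) :
    ∫ ω, (∑ i : Fin n, ∑ j ∈ Finset.univ.erase i,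
        (I i j ω * Ca i j + ∑ l : Fin n, I i j ω * J i j l ω * Cr i l)) ∂μ
      =
    2 * ∑ i : Fin n, ∑ j ∈ Finset.Ioi i,
        (P i j * Ca i j
          + ((∑ l : Fin n, P i l) + (∑ l : Fin n, P j l)) * m / (2 * n)
            * Cr i j) := by
  have hIJ : ∀ i j, i ≠ j → ∀ l ∈ Finset.univ,
      Integrable (fun ω => I i j ω * J i j l ω * Cr i l) μ :=
    fun i j hij l _ => (hIJ_int i j l hij).mul_const _
  have hterm : ∀ i, ∀ j ∈ Finset.univ.erase i, Integrable
      (fun ω => I i j ω * Ca i j + ∑ l, I i j ω * J i j l ω * Cr i l) μ := by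
    intro i j hj
    have hij := (Finset.ne_of_mem_erase hj).symm
    exact ((hI_int i j hij).mul_const _).add (integrable_finsetSum _ (hIJ i j hij))
  have hexp : ∀ i, ∀ j ∈ Finset.univ.erase i,
      ∫ ω, (I i j ω * Ca i j + ∑ l, I i j ω * J i j l ω * Cr i l) ∂μ
        = P i j * Ca i j + ∑ l, (m : ℝ) / n * P i j * Cr i l := by
    intro i j hj
    have hij := (Finset.ne_of_mem_erase hj).symm
    rw [integral_add ((hI_int i j hij).mul_const _) (integrable_finsetSum _ (hIJ i j hij)),
      integral_finsetSum _ (hIJ i j hij)]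
    simp only [integral_mul_const, hI_exp i j hij, hIJ_exp i j _ hij]
  rw [integral_finsetSum _ fun i _ => integrable_finsetSum _ (hterm i),
    ← sum_sum_eq_two_mul_sum_Ioi]
  · calc
      _ = ∑ i, ∑ j, (P i j * Ca i j + ∑ l, (m : ℝ) / n * P i j * Cr i l) := by
        refine Finset.sum_congr rfl fun i _ => ?_
        rw [integral_finsetSum _ (hterm i), Finset.sum_congr rfl (hexp i)]
        exact Finset.sum_erase _ (by simp [hPdiag])
      _ = ∑ i, ∑ j, P i j * Ca i j
          + (m : ℝ) / n * ∑ i, ∑ j, ∑ l, P i j * Cr i l := by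
        simp only [Finset.sum_add_distrib, Finset.mul_sum, mul_assoc]
      _ = _ := by
        rw [sum_sum_sum_mul_eq_sum_sum_avg P Cr hCr_symm]
        simp only [Finset.mul_sum, ← Finset.sum_add_distrib]
        refine Finset.sum_congr rfl fun i _ => Finset.sum_congr rfl fun j _ => ?_
        ring
  · intro i j
    rw [hPsymm i j, hCa_symm i j, hCr_symm i j, add_comm (∑ l, P i l)]
  · intro i
    simp [hPdiag, hCr_diag]
end

section
/- Fix integers n ≥ 2 and p ≥ 1, reals a > 0 and b > 0, pairwise distinct points y_1, …, y_n ∈ ℝ^p, and reals p_{kl} for k, l ∈ {1,…,n} with p_{kl} = p_{lk} and p_{kk} = 0. Define C : (ℝ^p)^n → ℝ by C(y_1,…,y_n) := Σ_{k=1}^n Σ_{l≠k} [ p_{kl} · ln(1 + a‖y_k − y_l‖₂^{2b}) + (1 − p_{kl}) · (−ln(1 − (1 + a‖y_k − y_l‖₂^{2b})^{−1})) ]. Then for each i ∈ {1,…,n}, the function y ↦ C(y_1,…,y_{i−1}, y, y_{i+1},…,y_n) is differentiable at y_i, and its gradient there equals 2 · Σ_{j≠i} [ p_{ij} · (2ab‖y_i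 − y_j‖₂^{2(b−1)} / (1 + a‖y_i − y_j‖₂^{2b})) − (1 − p_{ij}) · (2b / (‖y_i − y_j‖₂² (1 + a‖y_i − y_j‖₂^{2b}))) ] · (y_i − y_j). -/
open Real Finset

/-- The gradient at `x` of a radial function about `c`, away from the centre. -/
lemma hasGradientAt_comp_norm_sub {E : Type*} [NormedAddCommGroup E] [InnerProductSpace ℝ E]
    [CompleteSpace E] {g : ℝ → ℝ} {g' : ℝ} {x c : E} (hxc : x ≠ c)
    (hg : HasDerivAt g g' ‖x - c‖) :
    HasGradientAt (fun y => g ‖y - c‖) ((g' / ‖x - c‖) • (x - c)) x := by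
  have hpos : 0 < ‖x - c‖ := norm_pos_iff.mpr (sub_ne_zero.mpr hxc)
  have hsq : HasFDerivAt (fun y : E => ‖y - c‖ ^ 2) (2 • innerSL ℝ (x - c)) x := by
    simpa using ((hasFDerivAt_id x).sub_const c).norm_sq
  have hnorm := hsq.sqrt (pow_pos hpos 2).ne'
  simp only [Real.sqrt_sq (norm_nonneg _)] at hnorm
  rw [hasGradientAt_iff_hasFDerivAt]
  refine (hg.comp_hasFDerivAt x hnorm).congr_fderiv ?_
  ext v
  simp
  field_simp

/-- The low-dimensional cost of a pair at distance `s` with input-space probability `w`. -/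
noncomputable def pairCost (a b w s : ℝ) : ℝ :=
  w * Real.log (1 + a * s ^ (2 * b))
    + (1 - w) * (-Real.log (1 - (1 + a * s ^ (2 * b))⁻¹))

/-- The derivative of `pairCost` with respect to the distance, divided by the distance. -/
noncomputable def pairForce (a b w s : ℝ) : ℝ :=
  w * (2 * a * b * s ^ (2 * (b - 1)) / (1 + a * s ^ (2 * b)))
    - (1 - w) * (2 * b / (s ^ 2 * (1 + a * s ^ (2 * b))))

lemma hasDerivAt_pairCost {a s : ℝ} (b w : ℝ) (ha : 0 < a) (hs : 0 < s) :
    HasDerivAt (pairCost a b w) (pairForce a b w s * s) s := by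
  have hu : 0 < s ^ (2 * b) := Real.rpow_pos_of_pos hs _
  have hq : 0 < 1 + a * s ^ (2 * b) := by positivity
  have hrep : 1 - (1 + a * s ^ (2 * b))⁻¹ = a * s ^ (2 * b) / (1 + a * s ^ (2 * b)) := by
    field_simp
    ring
  have hrep_ne : 1 - (1 + a * s ^ (2 * b))⁻¹ ≠ 0 := by rw [hrep]; positivity
  have hd : HasDerivAt (fun t : ℝ => 1 + a * t ^ (2 * b))
      (a * (2 * b * s ^ (2 * b - 1))) s :=
    ((Real.hasDerivAt_rpow_const (Or.inl hs.ne')).const_mul a).const_add 1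
  have h := ((hd.log hq.ne').const_mul w).add
    ((((hd.fun_inv hq.ne').const_sub 1).log hrep_ne).neg.const_mul (1 - w))
  refine h.congr_deriv ?_
  have hexp : s ^ (2 * (b - 1)) = s ^ (2 * b) / s ^ 2 := by
    rw [show 2 * (b - 1) = 2 * b - (2 : ℕ) by push_cast; ring, Real.rpow_sub_natCast hs.ne']
  rw [pairForce, hrep, hexp, Real.rpow_sub_one hs.ne']
  field_simp
  ring

lemma hasGradientAt_pairCost {E : Type*} [NormedAddCommGroup E] [InnerProductSpace ℝ E]
    [CompleteSpace E] {a : ℝ} (b w : ℝ) (ha : 0 < a) {x c : E} (hxc : x ≠ c) :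
    HasGradientAt (fun y => pairCost a b w ‖y - c‖)
      (pairForce a b w ‖x - c‖ • (x - c)) x := by
  have hpos : 0 < ‖x - c‖ := norm_pos_iff.mpr (sub_ne_zero.mpr hxc)
  simpa [hpos.ne'] using hasGradientAt_comp_norm_sub hxc (hasDerivAt_pairCost b w ha hpos)

lemma HasGradientAt.finsetSum {ι E : Type*} [NormedAddCommGroup E] [InnerProductSpace ℝ E]
    [CompleteSpace E] {t : Finset ι} {f : ι → E → ℝ} {f' : ι → E} {x : E}
    (h : ∀ k ∈ t, HasGradientAt (f k) (f' k) x) :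
    HasGradientAt (fun y => ∑ k ∈ t, f k y) (∑ k ∈ t, f' k) x := by
  rw [hasGradientAt_iff_hasFDerivAt, map_sum]
  exact HasFDerivAt.fun_sum fun k hk => (h k hk).hasFDerivAt

/-- Summing over ordered pairs of distinct indices a quantity that only sees the pairs
containing `i` counts every other index twice. -/
lemma sum_sum_erase_ite {ι M : Type*} [Fintype ι] [DecidableEq ι] [AddCommMonoid M]
    (i : ι) (G : ι → M) :
    ∑ k, ∑ l ∈ Finset.univ.erase k, (if k = i then G l else if l = i then G k else 0)
      = 2 • ∑ j ∈ Finset.univ.erase i, G j := by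
  rw [← Finset.add_sum_erase _ _ (Finset.mem_univ i), two_nsmul]
  congr 1
  · simp
  · refine Finset.sum_congr rfl fun k hk => ?_
    have hki := Finset.ne_of_mem_erase hk
    simp [hki, hki.symm]

/-- gradient of UMAP's reduced cost function
`C(y_1,…,y_n) = Σ_k Σ_{l≠k} [p_{kl} ln(1 + a‖y_k − y_l‖^{2b})
  + (1 − p_{kl})(−ln(1 − (1 + a‖y_k − y_l‖^{2b})⁻¹))]`
with respect to `y_i`, at pairwise distinct points: the gradient is
`2 Σ_{j≠i} [p_{ij} (2ab‖y_i − y_j‖^{2(b−1)}/(1 + a‖y_i − y_j‖^{2b}))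
  − (1 − p_{ij}) (2b/(‖y_i − y_j‖² (1 + a‖y_i − y_j‖^{2b})))] • (y_i − y_j)`. -/
theorem umap_cost_gradient
    (n p : ℕ) (hn : 2 ≤ n) (hp : 1 ≤ p) (a b : ℝ) (ha : 0 < a) (hb : 0 < b)
    (Y : Fin n → EuclideanSpace ℝ (Fin p)) (hY : Function.Injective Y)
    (P : Fin n → Fin n → ℝ) (hPsymm : ∀ k l, P k l = P l k)
    (hPdiag : ∀ k, P k k = 0) (i : Fin n) :
    HasGradientAt (fun y : EuclideanSpace ℝ (Fin p) =>
        ∑ k : Fin n, ∑ l ∈ Finset.univ.erase k,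
          (P k l * Real.log (1 + a *
              ‖Function.update Y i y k - Function.update Y i y l‖ ^ (2 * b))
            + (1 - P k l) * (-Real.log (1 - (1 + a *
              ‖Function.update Y i y k - Function.update Y i y l‖ ^ (2 * b))⁻¹))))
      ((2 : ℝ) • ∑ j ∈ Finset.univ.erase i,
        (P i j * (2 * a * b * ‖Y i - Y j‖ ^ (2 * (b - 1))
            / (1 + a * ‖Y i - Y j‖ ^ (2 * b)))
          - (1 - P i j) * (2 * b
            / (‖Y i - Y j‖ ^ 2 * (1 + a * ‖Y i - Y j‖ ^ (2 * b)))))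
          • (Y i - Y j))
      (Y i) := by
  let G : Fin n → EuclideanSpace ℝ (Fin p) := fun j =>
    pairForce a b (P i j) ‖Y i - Y j‖ • (Y i - Y j)
  have key : HasGradientAt (fun y : EuclideanSpace ℝ (Fin p) =>
      ∑ k : Fin n, ∑ l ∈ Finset.univ.erase k,
        pairCost a b (P k l) ‖Function.update Y i y k - Function.update Y i y l‖)
      (∑ k : Fin n, ∑ l ∈ Finset.univ.erase k,
        if k = i then G l else if l = i then G k else 0) (Y i) := by
    refine HasGradientAt.finsetSum fun k _ => HasGradientAt.finsetSum fun l hl => ?_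
    have hlk := Finset.ne_of_mem_erase hl
    by_cases hk : k = i
    · subst hk
      simpa [hlk, G] using hasGradientAt_pairCost b (P k l) ha (hY.ne hlk.symm)
    · by_cases hli : l = i
      · subst hli
        simpa [hk, G, norm_sub_rev (Y k), hPsymm k l] using
          hasGradientAt_pairCost b (P l k) ha (hY.ne hlk)
      · simpa [hk, hli] using hasGradientAt_const (Y i) (pairCost a b (P k l) ‖Y k - Y l‖)
  rw [sum_sum_erase_ite, ← Nat.cast_smul_eq_nsmul ℝ, Nat.cast_ofNat] at key
  exact key
end
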